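/- Let W₁, W₂ be independent standard Brownian motions, let T > 0, and let S be a 2 × 2 real symmetric positive semidefinite matrix with eigenvalues θ₁² and θ₂², where θ₁, θ₂ > 0. Writing X(u) = (W₁(u), W₂(u)) and X̄ = T^{−1} ∫_0^T X(u) du, one has E[ exp( −(1/2) ∫_0^T (X(u) − X̄) · S (X(u) − X̄) du ) ] = ( θ₁ θ₂ T² / ( sinh(θ₁ T) sinh(θ₂ T) ) )^{1/2}. -/

import Mathlib

open MeasureTheory ProbabilityTheory Filter Matrix

/-- `W` is a standard Brownian motion under `P`: it is measurable in `ω` for each time,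
has continuous paths on `[0,∞)`, starts at `0`, and every finite linear combination
`∑ i, c i * W (t i)` with times `t i ≥ 0` is a centered Gaussian with variance
`∑ i, ∑ j, c i * c j * min (t i) (t j)` (i.e. `W` is a centered Gaussian process with
covariance `Cov(W s, W t) = min s t`). -/
def IsStdBM {Ω : Type*} [MeasurableSpace Ω] (P : Measure Ω) (W : ℝ → Ω → ℝ) : Prop :=
  (∀ t : ℝ, Measurable (W t)) ∧
  (∀ ω, ContinuousOn (fun t => W t ω) (Set.Ici 0)) ∧
  (∀ ω, W 0 ω = 0) ∧
  ∀ (n : ℕ) (t : Fin n → ℝ) (c : Fin n → ℝ), (∀ i, 0 ≤ t i) →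
    P.map (fun ω => ∑ i, c i * W (t i) ω) =
      gaussianReal 0 (∑ i, ∑ j, c i * c j * min (t i) (t j)).toNNReal

open scoped Topology

/-- The Riemann–Stieltjes sum of the path `h` against `dF` on the uniform grid of `[0, T]`. -/
noncomputable def stieltjesSum (T : ℝ) (F h : ℝ → ℝ) (n : ℕ) : ℝ :=
  ∑ i ∈ Finset.range n, h (i * (T / n)) * (F ((i + 1 : ℕ) * (T / n)) - F (i * (T / n)))

theorem measurable_stieltjesSum (T : ℝ) (F : ℝ → ℝ) (n : ℕ) :
    Measurable fun h : ℝ → ℝ => stieltjesSum T F h n :=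
  Finset.measurable_sum _ fun _ _ => (measurable_pi_apply _).mul_const _

theorem tendsto_stieltjesSum {T : ℝ} (hT : 0 < T) {h F f : ℝ → ℝ}
    (hh : ContinuousOn h (Set.Icc 0 T)) (hF : ∀ x, HasDerivAt F (f x) x) (hf : Continuous f) :
    Tendsto (stieltjesSum T F h) atTop (𝓝 (∫ u in (0 : ℝ)..T, h u * f u)) := by
  obtain ⟨C, hC⟩ := isCompact_Icc.exists_bound_of_continuousOn (hf.continuousOn (s := Set.Icc 0 T))
  have hC0 : 0 ≤ C := (norm_nonneg _).trans (hC 0 ⟨le_rfl, hT.le⟩)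
  have huc : UniformContinuousOn h (Set.Icc 0 T) :=
    isCompact_Icc.uniformContinuousOn_of_continuous hh
  rw [Metric.tendsto_atTop]
  intro ε hε
  obtain ⟨δ, hδ, hδh⟩ := Metric.uniformContinuousOn_iff.1 huc (ε / (2 * (C + 1) * T)) (by positivity)
  obtain ⟨N, hN⟩ := exists_nat_gt (T / δ)
  refine ⟨N + 1, fun n hn => ?_⟩
  have hn0 : (0 : ℝ) < n := by exact_mod_cast (by omega : 0 < n)
  have hd : 0 < T / n := by positivity
  have hdδ : T / n < δ := by
    rw [div_lt_iff₀ hn0]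
    rw [div_lt_iff₀ hδ] at hN
    have : (N : ℝ) ≤ n := by exact_mod_cast (by omega : N ≤ n)
    nlinarith
  have hmem : ∀ i < n, Set.Icc ((i : ℝ) * (T / n)) ((i + 1 : ℕ) * (T / n)) ⊆ Set.Icc 0 T := by
    intro i hi x hx
    refine ⟨le_trans (by positivity) hx.1, hx.2.trans ?_⟩
    have : ((i + 1 : ℕ) : ℝ) ≤ n := by exact_mod_cast hi
    calc ((i + 1 : ℕ) : ℝ) * (T / n) ≤ n * (T / n) := by gcongr
      _ = T := by field_simp
  have hle : ∀ i : ℕ, (i : ℝ) * (T / n) ≤ (i + 1 : ℕ) * (T / n) := fun i => by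
    gcongr; simp
  have hintegrable : ∀ i < n, IntervalIntegrable (fun u => h u * f u) volume
      ((i : ℝ) * (T / n)) ((i + 1 : ℕ) * (T / n)) := fun i hi => by
    apply ContinuousOn.intervalIntegrable
    rw [Set.uIcc_of_le (hle i)]
    exact (hh.mono (hmem i hi)).mul hf.continuousOn
  have hsum := intervalIntegral.sum_integral_adjacent_intervals (μ := volume)
    (f := fun u => h u * f u) (a := fun i : ℕ => (i : ℝ) * (T / n)) (n := n) hintegrable
  have e1 : (n : ℝ) * (T / n) = T := by field_simp
  simp only [Nat.cast_zero, zero_mul, e1] at hsum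
  rw [← hsum, dist_eq_norm, stieltjesSum, ← Finset.sum_sub_distrib]
  have hterm : ∀ i ∈ Finset.range n, ‖h (i * (T / n)) * (F ((i + 1 : ℕ) * (T / n)) - F (i * (T / n)))
      - ∫ u in ((i : ℝ) * (T / n))..((i + 1 : ℕ) * (T / n)), h u * f u‖
      ≤ (ε / (2 * (C + 1) * T)) * C * (T / n) := by
    intro i hi
    have hi := Finset.mem_range.1 hi
    have hFi := intervalIntegral.integral_eq_sub_of_hasDerivAt (a := (i : ℝ) * (T / n))
      (b := (i + 1 : ℕ) * (T / n)) (fun x _ => hF x) (hf.intervalIntegrable _ _)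
    rw [← hFi, ← intervalIntegral.integral_const_mul, ← intervalIntegral.integral_sub
      ((hf.intervalIntegrable _ _).const_mul _) (hintegrable i hi)]
    refine (intervalIntegral.norm_integral_le_of_norm_le_const (C := (ε / (2 * (C + 1) * T)) * C)
      fun x hx => ?_).trans (le_of_eq ?_)
    · rw [Set.uIoc_of_le (hle i)] at hx
      have hx' := Set.Ioc_subset_Icc_self hx
      rw [← sub_mul, norm_mul]
      refine mul_le_mul ?_ (hC x (hmem i hi hx')) (norm_nonneg _) (by positivity)
      rw [← dist_eq_norm]
      refine (hδh _ (hmem i hi ⟨le_rfl, hle i⟩) _ (hmem i hi hx') ?_).le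
      rw [Real.dist_eq, abs_sub_comm, abs_of_nonneg (by linarith [hx.1])]
      have := hx.2
      push_cast at this
      linarith
    · rw [abs_of_nonneg (by linarith [hle i])]
      push_cast
      ring
  refine (norm_sum_le_of_le _ hterm).trans_lt ?_
  rw [Finset.sum_const, Finset.card_range, nsmul_eq_mul]
  have : (n : ℝ) * (ε / (2 * (C + 1) * T) * C * (T / n)) = ε / 2 * (C / (C + 1)) := by
    field_simp
  rw [this]
  have : C / (C + 1) ≤ 1 := by rw [div_le_one (by positivity)]; linarith
  nlinarith

theorem sum_range_sub_mul_cast (g : ℕ → ℝ) (n : ℕ) :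
    ∑ i ∈ Finset.range n, (g (i + 1) - g i) * i = ∑ l ∈ Finset.range n, (g n - g (l + 1)) := by
  induction n with
  | zero => simp
  | succ n ih =>
    rw [Finset.sum_range_succ, ih, Finset.sum_range_succ, sub_self, add_zero]
    simp only [Finset.sum_sub_distrib, Finset.sum_const, Finset.card_range, nsmul_eq_mul]
    ring

theorem sum_sum_increments_mul_min (g : ℕ → ℝ) (n : ℕ) :
    ∑ i ∈ Finset.range n, ∑ j ∈ Finset.range n,
      (g (i + 1) - g i) * (g (j + 1) - g j) * min (i : ℝ) j
      = ∑ l ∈ Finset.range n, (g n - g (l + 1)) ^ 2 := by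
  induction n with
  | zero => simp
  | succ n ih =>
    have key := sum_range_sub_mul_cast g n
    have e1 : ∀ i ∈ Finset.range n, ∑ j ∈ Finset.range (n + 1),
        (g (i + 1) - g i) * (g (j + 1) - g j) * min (i : ℝ) j
        = ∑ j ∈ Finset.range n, (g (i + 1) - g i) * (g (j + 1) - g j) * min (i : ℝ) j
          + (g (n + 1) - g n) * ((g (i + 1) - g i) * i) := by
      intro i hi
      have : (i : ℝ) ≤ n := by exact_mod_cast (Finset.mem_range.1 hi).le
      rw [Finset.sum_range_succ, min_eq_left this]
      ring
    have e2 : ∑ j ∈ Finset.range n, (g (n + 1) - g n) * (g (j + 1) - g j) * min (n : ℝ) j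
        = (g (n + 1) - g n) * ∑ j ∈ Finset.range n, (g (j + 1) - g j) * j := by
      rw [Finset.mul_sum]
      refine Finset.sum_congr rfl fun j hj => ?_
      have : (j : ℝ) ≤ n := by exact_mod_cast (Finset.mem_range.1 hj).le
      rw [min_eq_right this]
      ring
    have e3 : ∀ l, (g (n + 1) - g (l + 1)) ^ 2 = (g n - g (l + 1)) ^ 2
        + 2 * (g (n + 1) - g n) * (g n - g (l + 1)) + (g (n + 1) - g n) ^ 2 := fun l => by ring
    rw [Finset.sum_range_succ, Finset.sum_congr rfl e1, Finset.sum_add_distrib, ih,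
      Finset.sum_range_succ _ n, e2, ← Finset.mul_sum, key, Finset.sum_range_succ _ n, min_self]
    rw [Finset.sum_congr rfl fun l _ => e3 l]
    rw [Finset.sum_add_distrib, Finset.sum_add_distrib, ← Finset.mul_sum]
    simp only [Finset.sum_const, Finset.card_range, nsmul_eq_mul]
    ring

section BrownianFunctional

variable {Ω : Type*} [MeasurableSpace Ω] {P : Measure Ω}

theorem IsStdBM.measurable_path {W : ℝ → Ω → ℝ} (hW : IsStdBM P W) :
    Measurable fun ω t => W t ω :=
  measurable_pi_lambda _ hW.1

theorem IsStdBM.map_stieltjesSum {W : ℝ → Ω → ℝ} (hW : IsStdBM P W) {T : ℝ} (hT : 0 < T)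
    {F : ℝ → ℝ} (hF0 : F 0 = 0) (hFT : F T = 0) {n : ℕ} (hn : 0 < n) :
    P.map (fun ω => stieltjesSum T F (fun t => W t ω) n) =
      gaussianReal 0 (stieltjesSum T id (fun t => F t ^ 2) n).toNNReal := by
  have hn' : (0 : ℝ) < n := by exact_mod_cast hn
  have e1 : (n : ℝ) * (T / n) = T := by field_simp
  have h := hW.2.2.2 n (fun i => (i : ℕ) * (T / n))
    (fun i => F (((i : ℕ) + 1 : ℕ) * (T / n)) - F ((i : ℕ) * (T / n)))
    (fun i => by positivity)
  have key := sum_sum_increments_mul_min (fun i => F (i * (T / n))) n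
  simp only [e1, hFT, zero_sub, neg_sq] at key
  have hshift : ∑ l ∈ Finset.range n, F ((l + 1 : ℕ) * (T / n)) ^ 2
      = ∑ l ∈ Finset.range n, F (l * (T / n)) ^ 2 := by
    have h1 := Finset.sum_range_succ (fun l : ℕ => F (l * (T / n)) ^ 2) n
    have h2 := Finset.sum_range_succ' (fun l : ℕ => F (l * (T / n)) ^ 2) n
    simp only [e1, hFT, Nat.cast_zero, zero_mul, hF0] at h1 h2
    linarith
  have hv : ∑ i : Fin n, ∑ j : Fin n,
      (F (((i : ℕ) + 1 : ℕ) * (T / n)) - F ((i : ℕ) * (T / n))) *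
      (F (((j : ℕ) + 1 : ℕ) * (T / n)) - F ((j : ℕ) * (T / n))) *
        min ((i : ℕ) * (T / n)) ((j : ℕ) * (T / n))
      = stieltjesSum T id (fun t => F t ^ 2) n := by
    have hmin : ∀ i j : ℕ, min ((i : ℝ) * (T / n)) (j * (T / n)) = min (i : ℝ) j * (T / n) :=
      fun i j => (min_mul_of_nonneg _ _ (by positivity)).symm
    simp only [hmin, ← mul_assoc, ← Finset.sum_mul]
    rw [Finset.sum_range fun i : ℕ => ∑ j ∈ Finset.range n, _] at key
    simp only [Finset.sum_range fun j : ℕ => _ * min _ _] at key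
    rw [key, hshift, stieltjesSum, Finset.sum_mul]
    refine Finset.sum_congr rfl fun i _ => ?_
    simp only [id]
    push_cast
    ring
  rw [hv] at h
  rw [← h]
  congr 1
  funext ω
  rw [stieltjesSum, Finset.sum_range]
  exact Finset.sum_congr rfl fun i _ => mul_comm _ _

theorem IsStdBM.charFun_map_stieltjesSum {W : ℝ → Ω → ℝ} (hW : IsStdBM P W) {T : ℝ} (hT : 0 < T)
    {F : ℝ → ℝ} (hF0 : F 0 = 0) (hFT : F T = 0) {n : ℕ} (hn : 0 < n) :
    charFun (P.map fun ω => stieltjesSum T F (fun t => W t ω) n) 1 =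
      Complex.exp (-(1 / 2) * (stieltjesSum T id (fun t => F t ^ 2) n : ℝ)) := by
  have h0 : 0 ≤ stieltjesSum T id (fun t => F t ^ 2) n := by
    refine Finset.sum_nonneg fun i _ => mul_nonneg (sq_nonneg _) ?_
    simp only [id]
    push_cast
    have : 0 ≤ T / n := by positivity
    linarith
  rw [hW.map_stieltjesSum hT hF0 hFT hn, charFun_gaussianReal, Real.coe_toNNReal _ h0]
  congr 1
  push_cast
  ring

theorem IsStdBM.tendsto_stieltjesSum {W : ℝ → Ω → ℝ} (hW : IsStdBM P W) {T : ℝ} (hT : 0 < T)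
    {F f : ℝ → ℝ} (hF : ∀ x, HasDerivAt F (f x) x) (hf : Continuous f) (ω : Ω) :
    Tendsto (fun n => stieltjesSum T F (fun t => W t ω) n) atTop
      (𝓝 (∫ u in (0 : ℝ)..T, W u ω * f u)) :=
  _root_.tendsto_stieltjesSum hT ((hW.2.1 ω).mono Set.Icc_subset_Ici_self) hF hf

theorem IsStdBM.measurable_integral_mul {W : ℝ → Ω → ℝ} (hW : IsStdBM P W) {T : ℝ} (hT : 0 < T)
    {f : ℝ → ℝ} (hf : Continuous f) :
    Measurable fun ω => ∫ u in (0 : ℝ)..T, W u ω * f u := by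
  have hF : ∀ x, HasDerivAt (fun x => ∫ u in (0 : ℝ)..x, f u) (f x) x := fun x =>
    intervalIntegral.integral_hasDerivAt_right (hf.intervalIntegrable _ _)
      (hf.stronglyMeasurableAtFilter _ _) hf.continuousAt
  have hm : ∀ n, Measurable fun ω =>
      stieltjesSum T (fun x => ∫ u in (0 : ℝ)..x, f u) (fun t => W t ω) n := fun n =>
    (measurable_stieltjesSum T (fun x => ∫ u in (0 : ℝ)..x, f u) n).comp hW.measurable_path
  exact measurable_of_tendsto_metrizable hm
    (tendsto_pi_nhds.2 fun ω => hW.tendsto_stieltjesSum hT hF hf ω)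

theorem integral_cexp_stieltjesSum_add [IsProbabilityMeasure P] {W₁ W₂ : ℝ → Ω → ℝ}
    (hW₁ : IsStdBM P W₁) (hW₂ : IsStdBM P W₂)
    (hindep : IndepFun (fun ω => fun t => W₁ t ω) (fun ω => fun t => W₂ t ω) P)
    {T : ℝ} (hT : 0 < T) {F₁ F₂ : ℝ → ℝ} (hF₁0 : F₁ 0 = 0) (hF₁T : F₁ T = 0)
    (hF₂0 : F₂ 0 = 0) (hF₂T : F₂ T = 0) {n : ℕ} (hn : 0 < n) :
    ∫ ω, Complex.exp (((stieltjesSum T F₁ (fun t => W₁ t ω) n +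
        stieltjesSum T F₂ (fun t => W₂ t ω) n : ℝ) : ℂ) * Complex.I) ∂P
      = Complex.exp (-(1 / 2) * ((stieltjesSum T id (fun t => F₁ t ^ 2) n +
        stieltjesSum T id (fun t => F₂ t ^ 2) n : ℝ) : ℂ)) := by
  have hm₁ : Measurable fun ω => stieltjesSum T F₁ (fun t => W₁ t ω) n :=
    (measurable_stieltjesSum T F₁ n).comp hW₁.measurable_path
  have hm₂ : Measurable fun ω => stieltjesSum T F₂ (fun t => W₂ t ω) n :=
    (measurable_stieltjesSum T F₂ n).comp hW₂.measurable_path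
  have hi : IndepFun (fun ω => stieltjesSum T F₁ (fun t => W₁ t ω) n)
      (fun ω => stieltjesSum T F₂ (fun t => W₂ t ω) n) P :=
    hindep.comp (measurable_stieltjesSum T F₁ n) (measurable_stieltjesSum T F₂ n)
  have h := congrFun (hi.charFun_map_fun_add_eq_mul hm₁.aemeasurable hm₂.aemeasurable) 1
  have hm : Measurable fun ω => stieltjesSum T F₁ (fun t => W₁ t ω) n +
      stieltjesSum T F₂ (fun t => W₂ t ω) n := hm₁.add hm₂
  rw [Pi.mul_apply, hW₁.charFun_map_stieltjesSum hT hF₁0 hF₁T hn,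
    hW₂.charFun_map_stieltjesSum hT hF₂0 hF₂T hn, ← Complex.exp_add, charFun_apply_real,
    integral_map hm.aemeasurable (by fun_prop)] at h
  simp only [Complex.ofReal_one, one_mul] at h
  rw [h]
  congr 1
  push_cast
  ring

theorem integral_cexp_integral_mul_add [IsProbabilityMeasure P] {W₁ W₂ : ℝ → Ω → ℝ}
    (hW₁ : IsStdBM P W₁) (hW₂ : IsStdBM P W₂)
    (hindep : IndepFun (fun ω => fun t => W₁ t ω) (fun ω => fun t => W₂ t ω) P)
    {T : ℝ} (hT : 0 < T) {F₁ F₂ f₁ f₂ : ℝ → ℝ}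
    (hF₁ : ∀ x, HasDerivAt F₁ (f₁ x) x) (hf₁ : Continuous f₁) (hF₁0 : F₁ 0 = 0) (hF₁T : F₁ T = 0)
    (hF₂ : ∀ x, HasDerivAt F₂ (f₂ x) x) (hf₂ : Continuous f₂) (hF₂0 : F₂ 0 = 0)
    (hF₂T : F₂ T = 0) :
    ∫ ω, Complex.exp ((((∫ u in (0 : ℝ)..T, W₁ u ω * f₁ u) +
        ∫ u in (0 : ℝ)..T, W₂ u ω * f₂ u : ℝ) : ℂ) * Complex.I) ∂P
      = Complex.exp (-(1 / 2) * (((∫ u in (0 : ℝ)..T, F₁ u ^ 2) +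
        ∫ u in (0 : ℝ)..T, F₂ u ^ 2 : ℝ) : ℂ)) := by
  have hm₁ : ∀ n, Measurable fun ω => stieltjesSum T F₁ (fun t => W₁ t ω) n := fun n =>
    (measurable_stieltjesSum T F₁ n).comp hW₁.measurable_path
  have hm₂ : ∀ n, Measurable fun ω => stieltjesSum T F₂ (fun t => W₂ t ω) n := fun n =>
    (measurable_stieltjesSum T F₂ n).comp hW₂.measurable_path
  have hsq : ∀ {F f : ℝ → ℝ}, (∀ x, HasDerivAt F (f x) x) →
      Tendsto (fun n => stieltjesSum T id (fun t => F t ^ 2) n) atTop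
        (𝓝 (∫ u in (0 : ℝ)..T, F u ^ 2)) := fun {F f} hF => by
    have hc : Continuous F := continuous_iff_continuousAt.2 fun x => (hF x).continuousAt
    have := _root_.tendsto_stieltjesSum (F := id) (f := fun _ => 1) hT
      (h := fun t => F t ^ 2) (by fun_prop) (fun x => hasDerivAt_id x) continuous_const
    simpa only [mul_one] using this
  have hcont : Continuous fun x : ℝ => Complex.exp (-(1 / 2) * (x : ℂ)) := by fun_prop
  have hcontI : Continuous fun x : ℝ => Complex.exp ((x : ℂ) * Complex.I) := by fun_prop
  have hr := (hcont.tendsto _).comp ((hsq hF₁).add (hsq hF₂))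
  refine tendsto_nhds_unique (tendsto_integral_of_dominated_convergence
    (F := fun (n : ℕ) ω => Complex.exp (((stieltjesSum T F₁ (fun t => W₁ t ω) n +
        stieltjesSum T F₂ (fun t => W₂ t ω) n : ℝ) : ℂ) * Complex.I)) (fun _ => 1)
    (fun n => ?_) (integrable_const _) (fun n => ?_) (ae_of_all _ fun ω => ?_))
    (hr.congr' ?_)
  · exact (hcontI.measurable.comp ((hm₁ n).add (hm₂ n))).aestronglyMeasurable
  · exact ae_of_all _ fun ω => (Complex.norm_exp_ofReal_mul_I _).le
  · exact (hcontI.tendsto _).comp ((hW₁.tendsto_stieltjesSum hT hF₁ hf₁ ω).add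
      (hW₂.tendsto_stieltjesSum hT hF₂ hf₂ ω))
  · filter_upwards [eventually_gt_atTop 0] with n hn
    exact (integral_cexp_stieltjesSum_add hW₁ hW₂ hindep hT hF₁0 hF₁T hF₂0 hF₂T hn).symm

end BrownianFunctional

theorem map_pair_eq_pi_gaussianReal {Ω : Type*} [MeasurableSpace Ω] {P : Measure Ω}
    [IsProbabilityMeasure P] {ι : Type*} [Fintype ι] {U V : ι → Ω → ℝ}
    (hU : ∀ k, Measurable (U k)) (hV : ∀ k, Measurable (V k)) (v : ι → NNReal)
    (hchar : ∀ s r : ι → ℝ,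
      ∫ ω, Complex.exp (((∑ k, s k * U k ω + ∑ k, r k * V k ω : ℝ) : ℂ) * Complex.I) ∂P
        = Complex.exp (-(1 / 2) * ((∑ k, v k * s k ^ 2 + ∑ k, v k * r k ^ 2 : ℝ) : ℂ))) :
    P.map (fun ω k => (U k ω, V k ω)) =
      Measure.pi fun k => (gaussianReal 0 (v k)).prod (gaussianReal 0 (v k)) := by
  classical
  have hm : Measurable fun ω k => (U k ω, V k ω) :=
    measurable_pi_lambda _ fun k => (hU k).prodMk (hV k)
  have := Measure.isProbabilityMeasure_map (μ := P) hm.aemeasurable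
  have hone : ∀ (w : NNReal) (L : StrongDual ℝ ℝ),
      charFunDual (gaussianReal 0 w) L = Complex.exp (-(1 / 2) * (w * L 1 ^ 2 : ℝ)) := by
    intro w L
    have h : ∀ x : ℝ, L x = L 1 * x := fun x => by
      rw [← mul_one x, ← smul_eq_mul, map_smul, smul_eq_mul, smul_eq_mul]; ring
    have h2 := charFun_gaussianReal (μ := 0) (v := w) (L 1)
    rw [charFun_apply_real] at h2
    rw [charFunDual_apply]
    simp only [fun x => congrArg Complex.ofReal (h x)]
    push_cast
    rw [h2]
    congr 1
    push_cast
    ring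
  rw [← charFunDual_eq_pi_iff]
  intro L
  simp_rw [charFunDual_prod, hone, ← Complex.exp_add, ← Complex.exp_sum]
  rw [charFunDual_apply, integral_map hm.aemeasurable (by fun_prop)]
  have hL : ∀ x : ι → ℝ × ℝ, L x = ∑ k, L (Pi.single k (1, 0)) * (x k).1
      + ∑ k, L (Pi.single k (0, 1)) * (x k).2 := by
    intro x
    have hx : x = ∑ k, ((x k).1 • (Pi.single k (1, 0) : ι → ℝ × ℝ)
        + (x k).2 • (Pi.single k (0, 1) : ι → ℝ × ℝ)) := by
      rw [← Finset.univ_sum_single x]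
      refine Finset.sum_congr rfl fun k _ => ?_
      rw [Finset.univ_sum_single, ← Pi.single_smul, ← Pi.single_smul, ← Pi.single_add]
      simp
    conv_lhs => rw [hx]
    rw [map_sum, ← Finset.sum_add_distrib]
    refine Finset.sum_congr rfl fun k _ => ?_
    rw [map_add, map_smul, map_smul, smul_eq_mul, smul_eq_mul]
    ring
  rw [integral_congr_ae (ae_of_all _ fun ω => by rw [hL])]
  rw [hchar]
  congr 1
  simp only [ContinuousLinearMap.comp_apply, ContinuousLinearMap.inl_apply,
    ContinuousLinearMap.inr_apply, ContinuousLinearMap.single_apply]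
  push_cast
  rw [← Finset.sum_add_distrib, Finset.mul_sum]
  refine Finset.sum_congr rfl fun k _ => by ring

theorem integral_exp_quadratic_gaussianReal {v : NNReal} (hv : v ≠ 0) {c : ℝ}
    (hc : 0 < 1 + v * c) (s : ℝ) :
    ∫ y, Real.exp (-(1 / 2) * (c * y ^ 2) + s * y) ∂(gaussianReal 0 v)
      = (√(1 + v * c))⁻¹ * Real.exp (v * s ^ 2 / (2 * (1 + v * c))) := by
  have hv0 : (0 : ℝ) < v := by positivity
  obtain ⟨w, hw⟩ : ∃ w : NNReal, (w : ℝ) = v / (1 + v * c) := ⟨⟨_, by positivity⟩, rfl⟩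
  have hw0 : w ≠ 0 := by
    rw [← NNReal.coe_ne_zero, hw]
    positivity
  have hpdf : ∀ y, gaussianPDFReal 0 v y • Real.exp (-(1 / 2) * (c * y ^ 2) + s * y)
      = (√(1 + v * c))⁻¹ * (gaussianPDFReal 0 w y • Real.exp (s * y)) := by
    intro y
    have h1 : √(2 * Real.pi * v) = √(1 + v * c) * √(2 * Real.pi * w) := by
      rw [← Real.sqrt_mul hc.le, hw]
      congr 1
      field_simp
    have h2 : -(y - 0) ^ 2 / (2 * (v : ℝ)) + (-(1 / 2) * (c * y ^ 2) + s * y)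
        = -(y - 0) ^ 2 / (2 * (w : ℝ)) + s * y := by
      rw [hw]
      field_simp
      ring
    simp only [gaussianPDFReal_def, smul_eq_mul]
    rw [mul_assoc, ← Real.exp_add, h2, h1, mul_inv, Real.exp_add]
    ring
  rw [integral_gaussianReal_eq_integral_smul hv]
  simp_rw [hpdf]
  rw [integral_const_mul, ← integral_gaussianReal_eq_integral_smul hw0]
  have := mgf_gaussianReal (p := gaussianReal 0 w) (μ := 0) (v := w) (X := id)
    (by simp) s
  simp only [mgf, id] at this
  rw [this, hw]
  congr 2
  field_simp
  ring

theorem quadratic_form_nonneg {a b c : ℝ} (ha : 0 ≤ a) (hc : 0 ≤ c) (habc : b ^ 2 ≤ a * c)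
    (x y : ℝ) : 0 ≤ a * x ^ 2 + 2 * b * (x * y) + c * y ^ 2 := by
  rcases hc.eq_or_lt with rfl | hc
  · have : b = 0 := by nlinarith
    subst this
    nlinarith [mul_nonneg ha (sq_nonneg x)]
  · have : 0 ≤ c * (a * x ^ 2 + 2 * b * (x * y) + c * y ^ 2) := by
      nlinarith [sq_nonneg (c * y + b * x), mul_nonneg (sub_nonneg.2 habc) (sq_nonneg x)]
    exact nonneg_of_mul_nonneg_right this hc

theorem integral_exp_quadratic_gaussianReal_prod {v : NNReal} (hv : v ≠ 0) {a b c : ℝ}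
    (ha : 0 ≤ a) (hc : 0 ≤ c) (habc : b ^ 2 ≤ a * c) :
    ∫ p : ℝ × ℝ, Real.exp (-(1 / 2) * (a * p.1 ^ 2 + 2 * b * (p.1 * p.2) + c * p.2 ^ 2))
      ∂((gaussianReal 0 v).prod (gaussianReal 0 v))
      = (√(1 + v * (a + c) + v ^ 2 * (a * c - b ^ 2)))⁻¹ := by
  have hv0 : (0 : ℝ) < v := by positivity
  have hc1 : 0 < 1 + v * c := by positivity
  have hintegrable : Integrable (fun p : ℝ × ℝ =>
      Real.exp (-(1 / 2) * (a * p.1 ^ 2 + 2 * b * (p.1 * p.2) + c * p.2 ^ 2)))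
      ((gaussianReal 0 v).prod (gaussianReal 0 v)) := by
    refine Integrable.of_bound (by fun_prop) 1 (ae_of_all _ fun p => ?_)
    rw [Real.norm_eq_abs, Real.abs_exp, Real.exp_le_one_iff]
    linarith [quadratic_form_nonneg ha hc habc p.1 p.2]
  rw [integral_prod _ hintegrable]
  have hinner : ∀ x : ℝ, ∫ y, Real.exp (-(1 / 2) * (a * x ^ 2 + 2 * b * (x * y) + c * y ^ 2))
      ∂(gaussianReal 0 v) = (√(1 + v * c))⁻¹ *
        Real.exp (-(1 / 2) * ((a - v * b ^ 2 / (1 + v * c)) * x ^ 2) + 0 * x) := by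
    intro x
    have h1 : ∀ y : ℝ, Real.exp (-(1 / 2) * (a * x ^ 2 + 2 * b * (x * y) + c * y ^ 2))
        = Real.exp (-(1 / 2) * (a * x ^ 2)) *
          Real.exp (-(1 / 2) * (c * y ^ 2) + (-(b * x)) * y) := by
      intro y
      rw [← Real.exp_add]
      congr 1
      ring
    simp_rw [h1]
    rw [integral_const_mul, integral_exp_quadratic_gaussianReal hv hc1, mul_left_comm,
      ← Real.exp_add]
    congr 2
    field_simp
    ring
  have hprod : (1 + v * c) * (1 + v * (a - v * b ^ 2 / (1 + v * c)))
      = 1 + v * (a + c) + v ^ 2 * (a * c - b ^ 2) := by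
    field_simp
    ring
  have hpos : 0 < 1 + (v : ℝ) * (a + c) + v ^ 2 * (a * c - b ^ 2) := by
    have : 0 ≤ a * c - b ^ 2 := by linarith
    positivity
  have ha1 : 0 < 1 + v * (a - v * b ^ 2 / (1 + v * c)) := by
    rw [← hprod] at hpos
    exact pos_of_mul_pos_right hpos hc1.le
  simp_rw [hinner]
  rw [integral_const_mul, integral_exp_quadratic_gaussianReal hv ha1, ← hprod,
    Real.sqrt_mul hc1.le]
  simp [mul_comm]

theorem tendsto_prod_sinh {x : ℝ} (hx : x ≠ 0) :
    Tendsto (fun n : ℕ => ∏ j ∈ Finset.range n, (1 + x ^ 2 / (((j : ℝ) + 1) * Real.pi) ^ 2))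
      atTop (𝓝 (Real.sinh x / x)) := by
  have h := Complex.tendsto_euler_sin_prod (x / Real.pi * Complex.I)
  have hpi : (Real.pi : ℂ) ≠ 0 := by exact_mod_cast Real.pi_ne_zero
  have e1 : (Real.pi : ℂ) * (x / Real.pi * Complex.I) = x * Complex.I := by field_simp
  have e2 : ∀ j : ℕ, (1 : ℂ) - (x / Real.pi * Complex.I) ^ 2 / ((j : ℂ) + 1) ^ 2
      = ((1 + x ^ 2 / (((j : ℝ) + 1) * Real.pi) ^ 2 : ℝ) : ℂ) := by
    intro j
    rw [mul_pow, Complex.I_sq, mul_pow]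
    push_cast
    have : (j : ℂ) + 1 ≠ 0 := Nat.cast_add_one_ne_zero j
    field_simp
    ring
  simp_rw [e1, e2, Complex.sin_mul_I] at h
  have h2 := ((Complex.continuous_im.tendsto _).comp h).div_const x
  rw [← Complex.ofReal_sinh] at h2
  have e3 : ((Real.sinh x : ℂ) * Complex.I).im = Real.sinh x := by
    rw [Complex.im_ofReal_mul, Complex.I_im, mul_one]
  rw [e3] at h2
  refine h2.congr fun n => ?_
  rw [Function.comp_apply, ← Complex.ofReal_prod, mul_right_comm, ← Complex.ofReal_mul,
    Complex.im_ofReal_mul, Complex.I_im, mul_one, mul_div_cancel_left₀ _ hx]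

theorem integral_cos_int_mul {T : ℝ} (hT : 0 < T) {n : ℤ} (hn : n ≠ 0) :
    ∫ u in (0 : ℝ)..T, Real.cos (n * Real.pi / T * u) = 0 := by
  have : (n : ℝ) * Real.pi / T ≠ 0 := by
    have : (n : ℝ) ≠ 0 := by exact_mod_cast hn
    have := Real.pi_ne_zero
    positivity
  rw [intervalIntegral.integral_comp_mul_left _ this]
  simp only [mul_zero, integral_cos, Real.sin_zero, sub_zero]
  rw [div_mul_cancel₀ _ hT.ne', Real.sin_int_mul_pi, smul_zero]

theorem integral_sin_mul_sin {T : ℝ} (hT : 0 < T) (j k : ℕ) :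
    ∫ u in (0 : ℝ)..T, Real.sin ((j + 1) * Real.pi / T * u) * Real.sin ((k + 1) * Real.pi / T * u)
      = if j = k then T / 2 else 0 := by
  have h : ∀ u, Real.sin ((j + 1) * Real.pi / T * u) * Real.sin ((k + 1) * Real.pi / T * u)
      = 1 / 2 * (Real.cos (((j - k : ℤ) : ℝ) * Real.pi / T * u)
        - Real.cos (((j + k + 2 : ℤ) : ℝ) * Real.pi / T * u)) := by
    intro u
    have e1 : ((j - k : ℤ) : ℝ) * Real.pi / T * u
        = (j + 1) * Real.pi / T * u - (k + 1) * Real.pi / T * u := by push_cast; ring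
    have e2 : ((j + k + 2 : ℤ) : ℝ) * Real.pi / T * u
        = (j + 1) * Real.pi / T * u + (k + 1) * Real.pi / T * u := by push_cast; ring
    rw [e1, e2, Real.cos_sub, Real.cos_add]
    ring
  simp_rw [h]
  rw [intervalIntegral.integral_const_mul, intervalIntegral.integral_sub
    (Continuous.intervalIntegrable (by fun_prop) _ _)
    (Continuous.intervalIntegrable (by fun_prop) _ _),
    integral_cos_int_mul hT (n := j + k + 2) (by positivity)]
  split_ifs with hjk
  · subst hjk
    simp
    ring
  · rw [integral_cos_int_mul hT (by omega)]
    simp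

theorem intervalIntegral_symm_eq {E : Type*} [NormedAddCommGroup E] [NormedSpace ℝ E] {T : ℝ}
    (hT : 0 < T) {h : ℝ → E} (hh : ContinuousOn h (Set.Icc (-T) T)) :
    ∫ x in (-T)..T, h x = ∫ x in (0 : ℝ)..T, (h x + h (-x)) := by
  have h1 : IntervalIntegrable h volume (-T) 0 := by
    refine (hh.mono ?_).intervalIntegrable
    rw [Set.uIcc_of_le (by linarith)]
    exact Set.Icc_subset_Icc_right hT.le
  have h2 : IntervalIntegrable h volume 0 T := by
    refine (hh.mono ?_).intervalIntegrable
    rw [Set.uIcc_of_le hT.le]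
    exact Set.Icc_subset_Icc_left (by linarith)
  have h3 : IntervalIntegrable (fun x => h (-x)) volume 0 T := by
    have hneg : ContinuousOn (fun x => h (-x)) (Set.Icc (-T) T) :=
      hh.comp continuous_neg.continuousOn fun x hx => ⟨neg_le_neg hx.2, by linarith [hx.1]⟩
    refine (hneg.mono ?_).intervalIntegrable
    rw [Set.uIcc_of_le hT.le]
    exact Set.Icc_subset_Icc_left (by linarith)
  rw [intervalIntegral.integral_add h2 h3, intervalIntegral.integral_comp_neg, neg_zero, add_comm,
    intervalIntegral.integral_add_adjacent_intervals h1 h2]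

/-- The `k`-th cosine coefficient on `[0, T]`, for the (unnormalized) mode `cos ((k + 1) π u / T)`. -/
noncomputable def cosCoeff (T : ℝ) (f : ℝ → ℝ) (k : ℕ) : ℝ :=
  ∫ u in (0 : ℝ)..T, f u * Real.cos ((k + 1) * Real.pi / T * u)

theorem fourierCoeffOn_even_extension {T : ℝ} (hT : 0 < T) {f : ℝ → ℝ}
    (hf : ContinuousOn f (Set.Icc 0 T)) (n : ℤ) :
    fourierCoeffOn (by linarith : -T < T) (fun x => (f |x| : ℂ)) n =
      ((T⁻¹ * ∫ u in (0 : ℝ)..T, f u * Real.cos (n * Real.pi / T * u) : ℝ) : ℂ) := by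
  have hg : ContinuousOn (fun x => (f |x| : ℂ)) (Set.Icc (-T) T) := by
    refine Complex.continuous_ofReal.comp_continuousOn (hf.comp continuous_abs.continuousOn ?_)
    exact fun x hx => ⟨abs_nonneg x, abs_le.2 hx⟩
  have he : ∀ x : ℝ, fourier (-n) (x : AddCircle (T - -T))
      = Complex.exp (((-(n * Real.pi / T * x) : ℝ) : ℂ) * Complex.I) := by
    intro x
    rw [fourier_coe_apply]
    congr 1
    have : (T : ℂ) ≠ 0 := by exact_mod_cast hT.ne'
    push_cast
    have e : (T : ℂ) - -T = 2 * T := by ring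
    rw [e]
    field_simp
  have hcont : Continuous fun x : ℝ =>
      Complex.exp (((-(n * Real.pi / T * x) : ℝ) : ℂ) * Complex.I) := by fun_prop
  rw [fourierCoeffOn_eq_integral]
  simp_rw [he]
  rw [intervalIntegral_symm_eq hT (hcont.continuousOn.fun_smul hg)]
  have hpt : Set.EqOn (fun x : ℝ =>
      Complex.exp (((-(n * Real.pi / T * x) : ℝ) : ℂ) * Complex.I) • (f |x| : ℂ) +
      Complex.exp (((-(n * Real.pi / T * -x) : ℝ) : ℂ) * Complex.I) • (f |-x| : ℂ))
      (fun x => ((2 * (f x * Real.cos (n * Real.pi / T * x)) : ℝ) : ℂ)) (Set.uIcc 0 T) := by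
    intro x hx
    rw [Set.uIcc_of_le hT.le] at hx
    simp only [abs_neg, abs_of_nonneg hx.1, mul_neg, neg_neg, smul_eq_mul, Complex.ofReal_mul,
      Complex.ofReal_cos, Complex.cos, Complex.ofReal_neg, Complex.ofReal_ofNat]
    ring
  rw [intervalIntegral.integral_congr hpt, intervalIntegral.integral_ofReal,
    intervalIntegral.integral_const_mul, Complex.real_smul, ← Complex.ofReal_mul]
  congr 1
  rw [sub_neg_eq_add]
  field_simp
  ring

theorem hasSum_cosCoeff_sq {T : ℝ} (hT : 0 < T) {f : ℝ → ℝ}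
    (hf : ContinuousOn f (Set.Icc 0 T)) :
    HasSum (fun k => 2 / T * cosCoeff T f k ^ 2)
      ((∫ u in (0 : ℝ)..T, f u ^ 2) - T⁻¹ * (∫ u in (0 : ℝ)..T, f u) ^ 2) := by
  have hab : -T < T := by linarith
  have hg : ContinuousOn (fun x => (f |x| : ℂ)) (Set.Icc (-T) T) := by
    refine Complex.continuous_ofReal.comp_continuousOn (hf.comp continuous_abs.continuousOn ?_)
    exact fun x hx => ⟨abs_nonneg x, abs_le.2 hx⟩
  have hmem : MemLp (fun x => (f |x| : ℂ)) 2 (volume.restrict (Set.Ioc (-T) T)) := by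
    obtain ⟨C, hC⟩ := isCompact_Icc.exists_bound_of_continuousOn hg
    refine MemLp.of_bound ((hg.mono Set.Ioc_subset_Icc_self).aestronglyMeasurable
      measurableSet_Ioc) C ?_
    filter_upwards [ae_restrict_mem measurableSet_Ioc] with x hx
    exact hC x (Set.Ioc_subset_Icc_self hx)
  have h := hasSum_sq_fourierCoeffOn hab hmem
  simp_rw [fourierCoeffOn_even_extension hT hf, Complex.norm_real, Real.norm_eq_abs, sq_abs] at h
  rw [intervalIntegral_symm_eq hT (by
    refine (hf.comp continuous_abs.continuousOn ?_).pow 2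
    exact fun x hx => ⟨abs_nonneg x, abs_le.2 hx⟩)] at h
  have hpt : Set.EqOn (fun x => f |x| ^ 2 + f |-x| ^ 2) (fun x => 2 * f x ^ 2) (Set.uIcc 0 T) := by
    intro x hx
    rw [Set.uIcc_of_le hT.le] at hx
    simp only [abs_neg, abs_of_nonneg hx.1]
    ring
  rw [intervalIntegral.integral_congr hpt, intervalIntegral.integral_const_mul] at h
  have h2 := h.nat_add_neg
  rw [← hasSum_nat_add_iff' 1] at h2
  have h3 := h2.mul_left T
  refine (congrArg₂ HasSum (funext fun k => ?_) ?_).mpr h3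
  · rw [cosCoeff]
    push_cast
    have hneg : ∀ u : ℝ, Real.cos ((-1 + -(k : ℝ)) * Real.pi / T * u)
        = Real.cos ((k + 1) * Real.pi / T * u) := fun u => by
      rw [← Real.cos_neg]
      congr 1
      ring
    simp only [neg_add_rev, hneg]
    field_simp
    ring
  · simp only [Finset.range_one, Finset.sum_singleton, Nat.cast_zero, neg_zero, Int.cast_zero,
      Int.cast_natCast, zero_mul, zero_div, Real.cos_zero, mul_one, smul_eq_mul]
    field_simp
    ring

theorem cosCoeff_add {T : ℝ} (hT : 0 < T) {f g : ℝ → ℝ}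
    (hf : ContinuousOn f (Set.Icc 0 T)) (hg : ContinuousOn g (Set.Icc 0 T)) (k : ℕ) :
    cosCoeff T (fun u => f u + g u) k = cosCoeff T f k + cosCoeff T g k := by
  have hI : ∀ {h : ℝ → ℝ}, ContinuousOn h (Set.Icc 0 T) → IntervalIntegrable
      (fun u => h u * Real.cos ((k + 1) * Real.pi / T * u)) volume 0 T := fun {h} hh => by
    apply ContinuousOn.intervalIntegrable
    rw [Set.uIcc_of_le hT.le]
    exact hh.mul (by fun_prop)
  simp only [cosCoeff]
  rw [← intervalIntegral.integral_add (hI hf) (hI hg)]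
  simp only [add_mul (f _)]

/-- Parseval's identity for the quadratic form of a planar path centered at its time average. -/
theorem hasSum_cosCoeff_quadratic {T : ℝ} (hT : 0 < T) {f g : ℝ → ℝ}
    (hf : ContinuousOn f (Set.Icc 0 T)) (hg : ContinuousOn g (Set.Icc 0 T)) (a b c : ℝ) :
    HasSum (fun k => 2 / T * (a * cosCoeff T f k ^ 2
        + 2 * b * (cosCoeff T f k * cosCoeff T g k) + c * cosCoeff T g k ^ 2))
      (∫ u in (0 : ℝ)..T,
        (a * (f u - T⁻¹ * ∫ v in (0 : ℝ)..T, f v) ^ 2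
        + 2 * b * ((f u - T⁻¹ * ∫ v in (0 : ℝ)..T, f v) * (g u - T⁻¹ * ∫ v in (0 : ℝ)..T, g v))
        + c * (g u - T⁻¹ * ∫ v in (0 : ℝ)..T, g v) ^ 2)) := by
  have hI : ∀ {h : ℝ → ℝ}, ContinuousOn h (Set.Icc 0 T) → IntervalIntegrable h volume 0 T :=
    fun {h} hh => by
      apply ContinuousOn.intervalIntegrable
      rwa [Set.uIcc_of_le hT.le]
  have hfi := hI hf
  have hgi := hI hg
  have hff : IntervalIntegrable (fun u => f u ^ 2) volume 0 T := hI (hf.pow 2)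
  have hgg : IntervalIntegrable (fun u => g u ^ 2) volume 0 T := hI (hg.pow 2)
  have hfg : IntervalIntegrable (fun u => f u * g u) volume 0 T := hI (hf.mul hg)
  have h := (((hasSum_cosCoeff_sq hT hf).mul_left (a - b)).add
    ((hasSum_cosCoeff_sq hT hg).mul_left (c - b))).add
    ((hasSum_cosCoeff_sq hT (hf.fun_add hg)).mul_left b)
  simp_rw [cosCoeff_add hT hf hg] at h
  refine (congrArg₂ HasSum (funext fun k => ?_) ?_).mpr h
  · ring
  · set F := ∫ v in (0 : ℝ)..T, f v with hF
    set G := ∫ v in (0 : ℝ)..T, g v with hG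
    have e1 : ∫ u in (0 : ℝ)..T, (f u + g u) = F + G := intervalIntegral.integral_add hfi hgi
    have e2 : ∫ u in (0 : ℝ)..T, (f u + g u) ^ 2 = (∫ u in (0 : ℝ)..T, f u ^ 2)
        + 2 * (∫ u in (0 : ℝ)..T, f u * g u) + ∫ u in (0 : ℝ)..T, g u ^ 2 := by
      rw [← intervalIntegral.integral_const_mul, ← intervalIntegral.integral_add hff
        (hfg.const_mul 2), ← intervalIntegral.integral_add (hff.add (hfg.const_mul 2)) hgg]
      congr 1
      funext u
      ring
    have e3 : ∀ u, a * (f u - T⁻¹ * F) ^ 2 + 2 * b * ((f u - T⁻¹ * F) * (g u - T⁻¹ * G))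
        + c * (g u - T⁻¹ * G) ^ 2
        = a * f u ^ 2 + 2 * b * (f u * g u) + c * g u ^ 2
          + (-(2 * T⁻¹ * (a * F + b * G))) * f u + (-(2 * T⁻¹ * (b * F + c * G))) * g u
          + T⁻¹ ^ 2 * (a * F ^ 2 + 2 * b * F * G + c * G ^ 2) := fun u => by ring
    simp_rw [e3]
    have i1 := hff.const_mul a
    have i2 := hfg.const_mul (2 * b)
    have i3 := hgg.const_mul c
    have i4 := hfi.const_mul (-(2 * T⁻¹ * (a * F + b * G)))
    have i5 := hgi.const_mul (-(2 * T⁻¹ * (b * F + c * G)))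
    rw [intervalIntegral.integral_add ((((i1.add i2).add i3).add i4).add i5)
        intervalIntegrable_const,
      intervalIntegral.integral_add (((i1.add i2).add i3).add i4) i5,
      intervalIntegral.integral_add ((i1.add i2).add i3) i4,
      intervalIntegral.integral_add (i1.add i2) i3, intervalIntegral.integral_add i1 i2]
    simp only [intervalIntegral.integral_const_mul, intervalIntegral.integral_const, smul_eq_mul,
      e1, e2, ← hF, ← hG]
    field_simp
    ring

/-- The trigonometric sine polynomial whose derivative is `∑ k, s k * cos ((k + 1) π u / T)`. -/
noncomputable def sinPrimitive (T : ℝ) {m : ℕ} (s : Fin m → ℝ) (u : ℝ) : ℝ :=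
  ∑ k : Fin m, s k * (T / ((k + 1) * Real.pi)) * Real.sin ((k + 1) * Real.pi / T * u)

theorem hasDerivAt_sinPrimitive {T : ℝ} (hT : 0 < T) {m : ℕ} (s : Fin m → ℝ) (u : ℝ) :
    HasDerivAt (sinPrimitive T s) (∑ k : Fin m, s k * Real.cos ((k + 1) * Real.pi / T * u)) u := by
  refine HasDerivAt.fun_sum fun k _ => ?_
  have h := ((hasDerivAt_id u).const_mul (((k : ℕ) + 1) * Real.pi / T)).sin.const_mul
    (s k * (T / (((k : ℕ) + 1) * Real.pi)))
  refine h.congr_deriv ?_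
  have : ((k : ℕ) : ℝ) + 1 ≠ 0 := Nat.cast_add_one_ne_zero _
  have := Real.pi_ne_zero
  simp only [id]
  field_simp

theorem sinPrimitive_zero (T : ℝ) {m : ℕ} (s : Fin m → ℝ) : sinPrimitive T s 0 = 0 := by
  simp [sinPrimitive]

theorem sinPrimitive_self {T : ℝ} (hT : 0 < T) {m : ℕ} (s : Fin m → ℝ) :
    sinPrimitive T s T = 0 := by
  refine Finset.sum_eq_zero fun k _ => ?_
  rw [div_mul_cancel₀ _ hT.ne', ← Nat.cast_add_one, Real.sin_nat_mul_pi, mul_zero]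

/-- The variance of the `k`-th cosine coefficient of a Brownian path on `[0, T]`. -/
noncomputable def cosCoeffVariance (T : ℝ) (k : ℕ) : NNReal :=
  (T / 2 * (T / ((k + 1) * Real.pi)) ^ 2).toNNReal

theorem coe_cosCoeffVariance {T : ℝ} (hT : 0 < T) (k : ℕ) :
    (cosCoeffVariance T k : ℝ) = T / 2 * (T / ((k + 1) * Real.pi)) ^ 2 :=
  Real.coe_toNNReal _ (by positivity)

theorem integral_sinPrimitive_sq {T : ℝ} (hT : 0 < T) {m : ℕ} (s : Fin m → ℝ) :
    ∫ u in (0 : ℝ)..T, sinPrimitive T s u ^ 2 = ∑ k : Fin m, cosCoeffVariance T k * s k ^ 2 := by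
  simp_rw [sinPrimitive, sq (∑ k : Fin m, _), Finset.sum_mul_sum]
  rw [intervalIntegral.integral_finsetSum fun j _ =>
    Continuous.intervalIntegrable (by fun_prop) _ _]
  refine Finset.sum_congr rfl fun j _ => ?_
  rw [intervalIntegral.integral_finsetSum fun k _ =>
    Continuous.intervalIntegrable (by fun_prop) _ _]
  simp_rw [mul_mul_mul_comm _ (Real.sin _), intervalIntegral.integral_const_mul,
    integral_sin_mul_sin hT, Fin.val_inj]
  simp only [mul_ite, mul_zero, Finset.sum_ite_eq, Finset.mem_univ, if_true,
    coe_cosCoeffVariance hT]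
  ring

theorem integral_mul_sum_cos {T : ℝ} (hT : 0 < T) {f : ℝ → ℝ}
    (hf : ContinuousOn f (Set.Icc 0 T)) {m : ℕ} (s : Fin m → ℝ) :
    ∫ u in (0 : ℝ)..T, f u * ∑ k : Fin m, s k * Real.cos ((k + 1) * Real.pi / T * u)
      = ∑ k : Fin m, s k * cosCoeff T f k := by
  simp_rw [Finset.mul_sum, mul_left_comm (f _)]
  rw [intervalIntegral.integral_finsetSum fun k _ => ?_]
  · simp_rw [intervalIntegral.integral_const_mul, cosCoeff]
  · apply ContinuousOn.intervalIntegrable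
    rw [Set.uIcc_of_le hT.le]
    exact continuousOn_const.mul (hf.mul (by fun_prop))

section CosineCoefficients

variable {Ω : Type*} [MeasurableSpace Ω] {P : Measure Ω}

theorem IsStdBM.continuousOn_Icc {W : ℝ → Ω → ℝ} (hW : IsStdBM P W) (T : ℝ) (ω : Ω) :
    ContinuousOn (fun t => W t ω) (Set.Icc 0 T) :=
  (hW.2.1 ω).mono Set.Icc_subset_Ici_self

theorem IsStdBM.measurable_cosCoeff {W : ℝ → Ω → ℝ} (hW : IsStdBM P W) {T : ℝ} (hT : 0 < T)
    (k : ℕ) : Measurable fun ω => cosCoeff T (fun u => W u ω) k :=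
  hW.measurable_integral_mul hT (by fun_prop)

theorem map_cosCoeff_eq_pi_gaussianReal [IsProbabilityMeasure P] {W₁ W₂ : ℝ → Ω → ℝ}
    (hW₁ : IsStdBM P W₁) (hW₂ : IsStdBM P W₂)
    (hindep : IndepFun (fun ω => fun t => W₁ t ω) (fun ω => fun t => W₂ t ω) P)
    {T : ℝ} (hT : 0 < T) (m : ℕ) :
    P.map (fun ω (k : Fin m) =>
        (cosCoeff T (fun u => W₁ u ω) k, cosCoeff T (fun u => W₂ u ω) k)) =
      Measure.pi fun k : Fin m =>
        (gaussianReal 0 (cosCoeffVariance T k)).prod (gaussianReal 0 (cosCoeffVariance T k)) := by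
  refine map_pair_eq_pi_gaussianReal (fun k : Fin m => hW₁.measurable_cosCoeff hT k)
    (fun k : Fin m => hW₂.measurable_cosCoeff hT k) (fun k : Fin m => cosCoeffVariance T k) fun s r => ?_
  have h := integral_cexp_integral_mul_add hW₁ hW₂ hindep hT
    (hasDerivAt_sinPrimitive hT s) (by fun_prop) (sinPrimitive_zero T s) (sinPrimitive_self hT s)
    (hasDerivAt_sinPrimitive hT r) (by fun_prop) (sinPrimitive_zero T r) (sinPrimitive_self hT r)
  simp_rw [integral_sinPrimitive_sq hT, integral_mul_sum_cos hT (hW₁.continuousOn_Icc T _),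
    integral_mul_sum_cos hT (hW₂.continuousOn_Icc T _)] at h
  exact h

theorem integral_exp_sum_cosCoeff_quadratic [IsProbabilityMeasure P] {W₁ W₂ : ℝ → Ω → ℝ}
    (hW₁ : IsStdBM P W₁) (hW₂ : IsStdBM P W₂)
    (hindep : IndepFun (fun ω => fun t => W₁ t ω) (fun ω => fun t => W₂ t ω) P)
    {T : ℝ} (hT : 0 < T) {a b c : ℝ} (ha : 0 ≤ a) (hc : 0 ≤ c) (habc : b ^ 2 ≤ a * c) (m : ℕ) :
    ∫ ω, Real.exp (-(1 / 2) * ∑ k ∈ Finset.range m,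
        2 / T * (a * cosCoeff T (fun u => W₁ u ω) k ^ 2
          + 2 * b * (cosCoeff T (fun u => W₁ u ω) k * cosCoeff T (fun u => W₂ u ω) k)
          + c * cosCoeff T (fun u => W₂ u ω) k ^ 2)) ∂P
      = ∏ k ∈ Finset.range m, (√(1 + (T / ((k + 1) * Real.pi)) ^ 2 * (a + c)
          + ((T / ((k + 1) * Real.pi)) ^ 2) ^ 2 * (a * c - b ^ 2)))⁻¹ := by
  have hm : Measurable fun ω (k : Fin m) =>
      (cosCoeff T (fun u => W₁ u ω) k, cosCoeff T (fun u => W₂ u ω) k) :=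
    measurable_pi_lambda _ fun k =>
      (hW₁.measurable_cosCoeff hT k).prodMk (hW₂.measurable_cosCoeff hT k)
  let q : ℝ × ℝ → ℝ := fun p => Real.exp (-(1 / 2) *
    (2 / T * a * p.1 ^ 2 + 2 * (2 / T * b) * (p.1 * p.2) + 2 / T * c * p.2 ^ 2))
  have hq : Continuous fun x : Fin m → ℝ × ℝ => ∏ k, q (x k) := by fun_prop
  calc _ = ∫ ω, ∏ k : Fin m,
          q (cosCoeff T (fun u => W₁ u ω) k, cosCoeff T (fun u => W₂ u ω) k) ∂P := by
        congr 1 with ω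
        rw [← Real.exp_sum, Finset.mul_sum, ← Fin.sum_univ_eq_sum_range (fun k : ℕ => -(1 / 2) *
          (2 / T * (a * cosCoeff T (fun u => W₁ u ω) k ^ 2
          + 2 * b * (cosCoeff T (fun u => W₁ u ω) k * cosCoeff T (fun u => W₂ u ω) k)
          + c * cosCoeff T (fun u => W₂ u ω) k ^ 2)))]
        congr 1
        refine Finset.sum_congr rfl fun k _ => ?_
        ring
    _ = ∏ k : Fin m, ∫ p, q p ∂((gaussianReal 0 (cosCoeffVariance T k)).prod
          (gaussianReal 0 (cosCoeffVariance T k))) := by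
        rw [← integral_map (f := fun x : Fin m → ℝ × ℝ => ∏ k, q (x k)) hm.aemeasurable
          hq.aestronglyMeasurable, map_cosCoeff_eq_pi_gaussianReal hW₁ hW₂ hindep hT,
          integral_fintype_prod_eq_prod (fun _ => q)]
    _ = _ := by
        rw [← Fin.prod_univ_eq_prod_range (fun k : ℕ => (√(1 + (T / ((k + 1) * Real.pi)) ^ 2
          * (a + c) + ((T / ((k + 1) * Real.pi)) ^ 2) ^ 2 * (a * c - b ^ 2)))⁻¹)]
        refine Finset.prod_congr rfl fun k _ => ?_
        have hv : cosCoeffVariance T k ≠ 0 := by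
          rw [cosCoeffVariance, Ne, Real.toNNReal_eq_zero, not_le]
          positivity
        rw [integral_exp_quadratic_gaussianReal_prod hv (by positivity) (by positivity)
          (by rw [mul_mul_mul_comm, mul_pow, ← sq]; gcongr), coe_cosCoeffVariance hT]
        congr 2
        field_simp

end CosineCoefficients

theorem tendsto_prod_inv_sqrt_sinh {T θ₁ θ₂ : ℝ} (hT : 0 < T) (hθ₁ : 0 < θ₁) (hθ₂ : 0 < θ₂) :
    Tendsto (fun m : ℕ => ∏ k ∈ Finset.range m,
        (√(1 + (T / ((k + 1) * Real.pi)) ^ 2 * (θ₁ ^ 2 + θ₂ ^ 2)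
          + ((T / ((k + 1) * Real.pi)) ^ 2) ^ 2 * (θ₁ ^ 2 * θ₂ ^ 2)))⁻¹) atTop
      (𝓝 (√(θ₁ * θ₂ * T ^ 2 / (Real.sinh (θ₁ * T) * Real.sinh (θ₂ * T))))) := by
  have h₁ := mul_pos hθ₁ hT
  have h₂ := mul_pos hθ₂ hT
  have hs₁ := Real.sinh_pos_iff.2 h₁
  have hs₂ := Real.sinh_pos_iff.2 h₂
  have h := (((tendsto_prod_sinh h₁.ne').mul (tendsto_prod_sinh h₂.ne')).inv₀
    (by positivity)).sqrt
  refine (congrArg₂ (fun u l => Tendsto u atTop (𝓝 l)) (funext fun m => ?_) ?_).mpr h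
  · rw [← Finset.prod_mul_distrib, ← Finset.prod_inv_distrib,
      Real.sqrt_prod _ fun k _ => by positivity]
    refine Finset.prod_congr rfl fun k _ => ?_
    rw [Real.sqrt_inv]
    congr 2
    field_simp
    ring
  · congr 1
    field_simp

/-- The eigenvalues of the real symmetric positive semidefinite 2×2 matrix `S` are
`θ₁²` and `θ₂²`; this is encoded (equivalently) via the trace and the determinant. -/
theorem stmt_3 {Ω : Type*} [MeasurableSpace Ω] (P : Measure Ω) [IsProbabilityMeasure P]
    (W₁ W₂ : ℝ → Ω → ℝ) (hW₁ : IsStdBM P W₁) (hW₂ : IsStdBM P W₂)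
    (hindep : IndepFun (fun ω => fun t => W₁ t ω) (fun ω => fun t => W₂ t ω) P)
    (T : ℝ) (hT : 0 < T)
    (S : Matrix (Fin 2) (Fin 2) ℝ) (hSsymm : S.IsSymm) (hSpsd : S.PosSemidef)
    (θ₁ θ₂ : ℝ) (hθ₁ : 0 < θ₁) (hθ₂ : 0 < θ₂)
    (htr : S.trace = θ₁ ^ 2 + θ₂ ^ 2) (hdet : S.det = θ₁ ^ 2 * θ₂ ^ 2) :
    ∫ ω, Real.exp (-(1 / 2) * ∫ u in (0:ℝ)..T,
        (fun i =>
            ![W₁ u ω, W₂ u ω] i - T⁻¹ * (∫ v in (0:ℝ)..T, ![W₁ v ω, W₂ v ω] i)) ⬝ᵥ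
          S.mulVec (fun i =>
            ![W₁ u ω, W₂ u ω] i - T⁻¹ * (∫ v in (0:ℝ)..T, ![W₁ v ω, W₂ v ω] i))) ∂P
      = Real.sqrt (θ₁ * θ₂ * T ^ 2 / (Real.sinh (θ₁ * T) * Real.sinh (θ₂ * T))) := by
  have hsym : S 1 0 = S 0 1 := hSsymm.apply 0 1
  rw [Matrix.trace_fin_two] at htr
  rw [Matrix.det_fin_two, hsym, ← sq] at hdet
  have ha : 0 ≤ S 0 0 := hSpsd.diag_nonneg
  have hc : 0 ≤ S 1 1 := hSpsd.diag_nonneg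
  have habc : S 0 1 ^ 2 ≤ S 0 0 * S 1 1 := by
    have : 0 ≤ θ₁ ^ 2 * θ₂ ^ 2 := by positivity
    linarith
  have hsum := fun ω => hasSum_cosCoeff_quadratic hT (hW₁.continuousOn_Icc T ω)
    (hW₂.continuousOn_Icc T ω) (S 0 0) (S 0 1) (S 1 1)
  have hform : ∀ x y : ℝ, (fun i => ![x, y] i) ⬝ᵥ S.mulVec (fun i => ![x, y] i)
      = S 0 0 * x ^ 2 + 2 * S 0 1 * (x * y) + S 1 1 * y ^ 2 := fun x y => by
    simp only [Matrix.mulVec, dotProduct, Fin.sum_univ_two, Matrix.cons_val_zero,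
      Matrix.cons_val_one, hsym]
    ring
  have hvec : ∀ (u : ℝ) (ω : Ω), (fun i =>
      ![W₁ u ω, W₂ u ω] i - T⁻¹ * (∫ v in (0:ℝ)..T, ![W₁ v ω, W₂ v ω] i))
      = fun i => ![W₁ u ω - T⁻¹ * ∫ v in (0:ℝ)..T, W₁ v ω,
        W₂ u ω - T⁻¹ * ∫ v in (0:ℝ)..T, W₂ v ω] i := fun u ω => by
    funext i
    fin_cases i <;> rfl
  simp_rw [hvec, hform]
  have hlim := tendsto_prod_inv_sqrt_sinh hT hθ₁ hθ₂
  rw [← htr, ← hdet] at hlim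
  simp_rw [← integral_exp_sum_cosCoeff_quadratic hW₁ hW₂ hindep hT ha hc habc] at hlim
  refine tendsto_nhds_unique (tendsto_integral_of_dominated_convergence (fun _ => 1)
    (fun m => ?_) (integrable_const 1) (fun m => ae_of_all _ fun ω => ?_)
    (ae_of_all _ fun ω => ?_)) hlim
  · have h₁ := hW₁.measurable_cosCoeff hT
    have h₂ := hW₂.measurable_cosCoeff hT
    exact Measurable.aestronglyMeasurable (by fun_prop)
  · rw [Real.norm_eq_abs, Real.abs_exp, Real.exp_le_one_iff, neg_mul, neg_nonpos]
    refine mul_nonneg (by norm_num) (Finset.sum_nonneg fun k _ => mul_nonneg (by positivity) ?_)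
    exact quadratic_form_nonneg ha hc habc _ _
  · exact (Real.continuous_exp.tendsto _).comp ((hsum ω).tendsto_sum_nat.const_mul _)
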